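/- If λ > μ, then no two distinct points of the image of Φ lie on a common line through the origin of Π: for all θ₁, θ₂ ∈ ℝ and all c ∈ ℝ, if Φ(θ₁) = c·Φ(θ₂) then Φ(θ₁) = Φ(θ₂). -/

import Mathlib

noncomputable section

open Real Set

/-- Membership predicate for conformally inscribed parallelograms.
Coordinates of `P : Fin 9 → ℝ`:
`0 = x_A, 1 = y_A, 2 = x_B, 3 = y_B, 4 = x_C, 5 = y_C, 6 = x_D, 7 = y_D, 8 = w`.
The vertex `(x_L, y_L)` lies on the line `L(w)` for `L ∈ {A,B,C,D}` and the
midpoints of the two diagonals coincide. -/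
def IsCIP (mA mB mC mD bA : ℝ) (P : Fin 9 → ℝ) : Prop :=
  P 1 = mA * P 0 + bA * P 8 ∧
  P 3 = mB * P 2 + P 8 ∧
  P 5 = mC * P 4 ∧
  P 7 = mD * P 6 ∧
  P 0 + P 4 = P 2 + P 6 ∧
  P 1 + P 5 = P 3 + P 7

/-- `Π`, the set of conformally inscribed parallelograms. -/
def CIP (mA mB mC mD bA : ℝ) : Set (Fin 9 → ℝ) := {P | IsCIP mA mB mC mD bA P}

/-- The `AC` diagonal vector of a parallelogram. -/
def vAC (P : Fin 9 → ℝ) : ℝ × ℝ := (P 0 - P 4, P 1 - P 5)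

/-- The `BD` diagonal vector of a parallelogram. -/
def vBD (P : Fin 9 → ℝ) : ℝ × ℝ := (P 2 - P 6, P 3 - P 7)

/-- The `AB` side vector of a parallelogram. -/
def vAB (P : Fin 9 → ℝ) : ℝ × ℝ := (P 0 - P 2, P 1 - P 3)

/-- The `BC` side vector of a parallelogram. -/
def vBC (P : Fin 9 → ℝ) : ℝ × ℝ := (P 2 - P 4, P 3 - P 5)

/-- Dot product in `ℝ²`. -/
def dot2 (a b : ℝ × ℝ) : ℝ := a.1 * b.1 + a.2 * b.2

/-- The inner product `⟨P, Q⟩ = P_AC · Q_AC + P_BD · Q_BD` on `Π`. -/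
def pinner (P Q : Fin 9 → ℝ) : ℝ := dot2 (vAC P) (vAC Q) + dot2 (vBD P) (vBD Q)

/-- The parametrization `Φ` of a conformal solution. -/
def Phi (U V T : Fin 9 → ℝ) (lam mu : ℝ) (θ : ℝ) : Fin 9 → ℝ :=
  (Real.sqrt (lam - mu * Real.cos θ ^ 2) / Real.sqrt (2 * lam)) • U +
    (Real.sin θ / Real.sqrt 2) • V + (Real.cos θ / Real.sqrt (2 * lam)) • T

theorem pinner_comm (P Q : Fin 9 → ℝ) : pinner P Q = pinner Q P := by
  simp only [pinner, dot2]
  ring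

theorem pinner_smul_left (c : ℝ) (P Q : Fin 9 → ℝ) : pinner (c • P) Q = c * pinner P Q := by
  simp only [pinner, dot2, vAC, vBD, Pi.smul_apply, smul_eq_mul]
  ring

theorem pinner_add_left (P Q R : Fin 9 → ℝ) :
    pinner (P + Q) R = pinner P R + pinner Q R := by
  simp only [pinner, dot2, vAC, vBD, Pi.add_apply]
  ring

theorem dot2_self_nonneg (a : ℝ × ℝ) : 0 ≤ dot2 a a :=
  add_nonneg (mul_self_nonneg _) (mul_self_nonneg _)

theorem stmt_14 (mA mB mC mD bA : ℝ) (hCD : mC ≠ mD)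
    (U V T : Fin 9 → ℝ)
    (hU : U ∈ CIP mA mB mC mD bA) (hV : V ∈ CIP mA mB mC mD bA)
    (hT : T ∈ CIP mA mB mC mD bA)
    (hUU : pinner U U = 1) (hVV : pinner V V = 1) (hTT : pinner T T = 1)
    (hUV : pinner U V = 0) (hUT : pinner U T = 0) (hVT : pinner V T = 0)
    (hspan : ∀ P ∈ CIP mA mB mC mD bA, ∃ u v t : ℝ, P = u • U + v • V + t • T)
    (hUAC : vAC U = (0, 0)) (hVBD : vBD V = (0, 0))
    (lam mu : ℝ) (hlam : lam = dot2 (vAC T) (vAC T)) (hmu : mu = dot2 (vBD T) (vBD T))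
    (hge : mu ≤ lam) :
    mu < lam → ∀ (θ₁ θ₂ c : ℝ),
      Phi U V T lam mu θ₁ = c • Phi U V T lam mu θ₂ →
      Phi U V T lam mu θ₁ = Phi U V T lam mu θ₂ := by
  intro hlt θ₁ θ₂ c h
  have hmu0 : 0 ≤ mu := hmu ▸ dot2_self_nonneg _
  have hlam0 : 0 < lam := hmu0.trans_lt hlt
  have hs : 0 < √(2 * lam) := Real.sqrt_pos.2 (by positivity)
  have coeffU (θ : ℝ) :
      pinner (Phi U V T lam mu θ) U = √(lam - mu * cos θ ^ 2) / √(2 * lam) := by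
    simp [Phi, pinner_add_left, pinner_smul_left, hUU, pinner_comm V U, hUV,
      pinner_comm T U, hUT]
  have coeffV (θ : ℝ) : pinner (Phi U V T lam mu θ) V = sin θ / √2 := by
    simp [Phi, pinner_add_left, pinner_smul_left, hVV, hUV, pinner_comm T V, hVT]
  have coeffT (θ : ℝ) : pinner (Phi U V T lam mu θ) T = cos θ / √(2 * lam) := by
    simp [Phi, pinner_add_left, pinner_smul_left, hTT, hUT, hVT]
  have coeffU_pos (θ : ℝ) : 0 < pinner (Phi U V T lam mu θ) U := by
    rw [coeffU]
    have : 0 < lam - mu * cos θ ^ 2 := by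
      nlinarith [mul_le_mul_of_nonneg_left (Real.cos_sq_le_one θ) hmu0]
    exact div_pos (Real.sqrt_pos.2 this) hs
  have hc : 0 < c := by
    have hU₁ := coeffU_pos θ₁
    rw [h, pinner_smul_left] at hU₁
    exact (pos_iff_pos_of_mul_pos hU₁).2 (coeffU_pos θ₂)
  have hsin : sin θ₁ = c * sin θ₂ := by
    have hV' := coeffV θ₁
    rw [h, pinner_smul_left, coeffV] at hV'
    field_simp at hV'
    exact hV'.symm
  have hcos : cos θ₁ = c * cos θ₂ := by
    have hT' := coeffT θ₁
    rw [h, pinner_smul_left, coeffT] at hT'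
    field_simp at hT'
    exact hT'.symm
  have hc_sq : c ^ 2 = 1 := by
    have h₁ := Real.sin_sq_add_cos_sq θ₁
    rw [hsin, hcos] at h₁
    linear_combination h₁ - c ^ 2 * Real.sin_sq_add_cos_sq θ₂
  have hc_one : c = 1 := (pow_eq_one_iff_of_nonneg hc.le two_ne_zero).1 hc_sq
  rw [h, hc_one, one_smul]
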